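/- arXiv:1806.07586 — 2 statements merged into one kernel-verified Lean document; each statement's English description precedes it below -/
import Mathlib

section
/- In every solution E′ to Disjoint A,B-paths on the instance I, for each v ∈ V the path of E′ having v′₁ as an endpoint has its other endpoint at v′₈ and is either the single edge v′₈v′₁ (of length 12) or the path v′₁v′₂⋯v′₈ (of length 11); moreover, the set S = {v ∈ V : the path of E′ joining v′₁ and v′₈ is v′₁v′₂⋯v′₈} is an independent set in G. -/
/-- `f` is a family of `(|A|+|B|)/2` pairwise vertex-disjoint simple paths of `G`,
each with both endpoints in `A` or both endpoints in `B`, such that every vertex of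
`A ∪ B` is an endpoint of one of the paths, and `E'` is the union of their edge
sets.  This witnesses that `E'` is a solution to Disjoint `A`,`B`-paths. -/
def IsPathFamily {V : Type} [DecidableEq V] (G : SimpleGraph V) (A B : Finset V)
    (E' : Set (Sym2 V)) {k : ℕ} (f : Fin k → (u : V) × (v : V) × G.Walk u v) : Prop :=
  k = (A.card + B.card) / 2 ∧
  (∀ i, (f i).2.2.IsPath) ∧
  (∀ i, ((f i).1 ∈ A ∧ (f i).2.1 ∈ A) ∨ ((f i).1 ∈ B ∧ (f i).2.1 ∈ B)) ∧
  (∀ i j, i ≠ j → ∀ x, x ∈ (f i).2.2.support → x ∉ (f j).2.2.support) ∧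
  (∀ z, z ∈ A ∪ B → ∃ i, z = (f i).1 ∨ z = (f i).2.1) ∧
  E' = ⋃ i, {e | e ∈ (f i).2.2.edges}

/-- `E'` is a solution to Disjoint `A`,`B`-paths on `G`. -/
def IsSolution {V : Type} [DecidableEq V] (G : SimpleGraph V) (A B : Finset V)
    (E' : Set (Sym2 V)) : Prop :=
  ∃ (k : ℕ) (f : Fin k → (u : V) × (v : V) × G.Walk u v), IsPathFamily G A B E' f

/-- The length of an edge set: the sum of the lengths of its edges. -/
noncomputable def lengthOf {V : Type} (ℓ : Sym2 V → ℕ) (E' : Set (Sym2 V)) : ℕ :=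
  ∑ᶠ e ∈ E', ℓ e

/-- `ℓ_{A,B}`: the minimum length of a solution to Disjoint `A`,`B`-paths. -/
noncomputable def lAB {V : Type} [DecidableEq V] (G : SimpleGraph V) (A B : Finset V)
    (ℓ : Sym2 V → ℕ) : ℕ :=
  sInf {n | ∃ E', IsSolution G A B E' ∧ lengthOf ℓ E' = n}

/-- `S_{A,B}`: the number of minimum-length solutions to Disjoint `A`,`B`-paths. -/
noncomputable def nSol {V : Type} [DecidableEq V] (G : SimpleGraph V) (A B : Finset V)
    (ℓ : Sym2 V → ℕ) : ℕ :=
  Set.ncard {E' | IsSolution G A B E' ∧ lengthOf ℓ E' = lAB G A B ℓ}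


/-- Vertex type of the instance `I`: `Sum.inl (v, i)` is the gadget-cycle vertex
`v′_{i+1}` (for `v ∈ V`, `i : Fin 8`), and `Sum.inr (e, k)` is the edge-gadget
vertex `w′_{k+1}(e)` (used only for edges `e` of `G`). -/
abbrev IVert (V : Type) : Type := (V × Fin 8) ⊕ (Sym2 V × Fin 2)

/-- Base relation of the instance `I`: for each vertex `v` of `G` an 8-cycle
`v′₁ … v′₈`, and for each edge `e = uv` of `G` (with `fs e = u`, `sn e = v`) the four
edges `w′₁(e)u′_{σ_u(e)}`, `w′₂(e)u′_{σ_u(e)+1}`, `w′₁(e)v′_{σ_v(e)+1}`,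
`w′₂(e)v′_{σ_v(e)}` (in the `Fin 8`-indexing, `v′_m` is `Sum.inl (v, m-1)`). -/
def iRel {V : Type} (G : SimpleGraph V) (σ : V → Sym2 V → ℕ) (fs sn : Sym2 V → V) :
    IVert V → IVert V → Prop
  | .inl (v, i), .inl (w, j) =>
      v = w ∧ (i.val + 1 = j.val ∨ (i.val = 7 ∧ j.val = 0))
  | .inr (e, k), .inl (w, i) => e ∈ G.edgeSet ∧
      ((k = 0 ∧ w = fs e ∧ i.val + 1 = σ w e) ∨
       (k = 1 ∧ w = fs e ∧ i.val = σ w e) ∨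
       (k = 0 ∧ w = sn e ∧ i.val = σ w e) ∨
       (k = 1 ∧ w = sn e ∧ i.val + 1 = σ w e))
  | _, _ => False

/-- The graph of the instance `I`. -/
def instGraph {V : Type} (G : SimpleGraph V) (σ : V → Sym2 V → ℕ)
    (fs sn : Sym2 V → V) : SimpleGraph (IVert V) :=
  SimpleGraph.fromRel (iRel G σ fs sn)

open Classical in
/-- Edge lengths of the instance `I`: the cycle edge `v′₈v′₁` has length `12`, the
cycle edges `v′ᵢv′ᵢ₊₁` with `i` odd (`Fin`-index even) have length `2`, and all other
edges have length `1`. -/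
noncomputable def instLen {V : Type} : Sym2 (IVert V) → ℕ := fun ε =>
  if ∃ v : V, ε = s((Sum.inl (v, (7 : Fin 8)) : IVert V), Sum.inl (v, (0 : Fin 8)))
  then 12
  else if ∃ (v : V) (i j : Fin 8), i.val % 2 = 0 ∧ i.val + 1 = j.val ∧
      ε = s((Sum.inl (v, i) : IVert V), Sum.inl (v, j))
  then 2
  else 1

/-- The terminal set `A` of the instance `I`: the vertices `v′₁` and `v′₈`, `v ∈ V`. -/
def instA (V : Type) [Fintype V] [DecidableEq V] : Finset (IVert V) :=
  Finset.univ.image (fun v : V => (Sum.inl (v, (0 : Fin 8)) : IVert V)) ∪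
    Finset.univ.image (fun v : V => (Sum.inl (v, (7 : Fin 8)) : IVert V))

/-- The terminal set `B` of the instance `I`: the vertices `w′₁(e)` and `w′₂(e)`,
`e ∈ E`. -/
def instB {V : Type} [Fintype V] [DecidableEq V] (G : SimpleGraph V)
    [DecidableRel G.Adj] : Finset (IVert V) :=
  G.edgeFinset.image (fun e => (Sum.inr (e, (0 : Fin 2)) : IVert V)) ∪
    G.edgeFinset.image (fun e => (Sum.inr (e, (1 : Fin 2)) : IVert V))

/-- The independence number `α(G)`. -/
noncomputable def indepNum {V : Type} (G : SimpleGraph V) : ℕ :=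
  sSup {n | ∃ S : Finset V, (∀ u ∈ S, ∀ w ∈ S, ¬ G.Adj u w) ∧ S.card = n}

/-- The edge set of the long path `v′₁v′₂⋯v′₈` (of length 11) around the gadget
cycle of `v`. -/
def longPathEdges {V : Type} (v : V) : Set (Sym2 (IVert V)) :=
  {ε | ∃ j : Fin 8, j.val < 7 ∧ ε = s((Sum.inl (v, j) : IVert V), Sum.inl (v, j + 1))}

open SimpleGraph

section PathFamily

variable {W : Type} [DecidableEq W] {H : SimpleGraph W} {A B : Finset W} {E' : Set (Sym2 W)}
  {k : ℕ} {f : Fin k → (u : W) × (w : W) × H.Walk u w}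

/-- A path of a family meets the terminals only in its endpoints. -/
lemma IsPathFamily.eq_fst_or_snd_of_mem_support (hf : IsPathFamily H A B E' f) {i : Fin k} {z : W}
    (hz : z ∈ A ∪ B) (hzi : z ∈ (f i).2.2.support) : z = (f i).1 ∨ z = (f i).2.1 := by
  obtain ⟨-, -, -, hdisj, hcov, -⟩ := hf
  obtain ⟨j, hj⟩ := hcov z hz
  have hzj : z ∈ (f j).2.2.support := by
    rcases hj with rfl | rfl
    exacts [Walk.start_mem_support _, Walk.end_mem_support _]
  obtain rfl : i = j := by_contra fun h => hdisj i j h z hzi hzj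
  exact hj

/-- If the terminal sets are disjoint, every path of a family has two distinct endpoints. -/
lemma IsPathFamily.fst_ne_snd (hf : IsPathFamily H A B E' f) (hAB : Disjoint A B) (i : Fin k) :
    (f i).1 ≠ (f i).2.1 := by
  intro h
  obtain ⟨hk, -, -, -, hcov, -⟩ := hf
  have hsub : A ∪ B ⊆ Finset.univ.image (fun j => (f j).1) ∪
      (Finset.univ.erase i).image (fun j => (f j).2.1) := by
    intro z hz
    obtain ⟨j, hj⟩ := hcov z hz
    simp only [Finset.mem_union, Finset.mem_image, Finset.mem_univ, true_and, Finset.mem_erase,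
      and_true]
    rcases hj with hj | hj
    · exact Or.inl ⟨j, hj.symm⟩
    · by_cases hji : j = i
      · subst hji
        exact Or.inl ⟨j, by rw [h, hj]⟩
      · exact Or.inr ⟨j, hji, hj.symm⟩
  have hcard := (Finset.card_le_card hsub).trans (Finset.card_union_le _ _)
  have h₁ := Finset.card_image_le (s := Finset.univ) (f := fun j => (f j).1)
  have h₂ := Finset.card_image_le (s := Finset.univ.erase i) (f := fun j => (f j).2.1)
  rw [Finset.card_erase_of_mem (Finset.mem_univ i)] at h₂
  rw [Finset.card_union_of_disjoint hAB] at hcard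
  simp only [Finset.card_univ, Fintype.card_fin] at h₁ h₂
  have := i.pos
  omega

end PathFamily

section Instance

variable {V : Type} {G : SimpleGraph V} {σ : V → Sym2 V → ℕ} {fs sn : Sym2 V → V}

/-- The neighbours of a vertex of a gadget cycle: its neighbours on the cycle, or vertices of
edge gadgets. -/
lemma instGraph_adj_inl {v : V} {j : Fin 8} {y : IVert V}
    (h : (instGraph G σ fs sn).Adj (.inl (v, j)) y) :
    (∃ i : Fin 8, y = .inl (v, i) ∧ (j.val + 1 = i.val ∨ i.val + 1 = j.val ∨
      (j.val = 7 ∧ i.val = 0) ∨ (i.val = 7 ∧ j.val = 0))) ∨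
    ∃ e ∈ G.edgeSet, ∃ l, y = .inr (e, l) := by
  obtain ⟨-, h⟩ := (fromRel_adj _ _ _).1 h
  rcases y with ⟨w, i⟩ | ⟨e, l⟩
  · left
    simp only [iRel] at h
    obtain ⟨rfl, h⟩ | ⟨rfl, h⟩ := h <;> exact ⟨i, rfl, by omega⟩
  · right
    simp only [iRel, false_or] at h
    exact ⟨e, h.1, l, rfl⟩

/-- The neighbours of a vertex of an edge gadget lie on the cycles of the ends of the edge. -/
lemma instGraph_adj_inr {e : Sym2 V} {l : Fin 2} {y : IVert V}
    (h : (instGraph G σ fs sn).Adj (.inr (e, l)) y) :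
    ∃ i : Fin 8, y = .inl (fs e, i) ∨ y = .inl (sn e, i) := by
  obtain ⟨-, h⟩ := (fromRel_adj _ _ _).1 h
  rcases y with ⟨w, i⟩ | ⟨e, l⟩
  · simp only [iRel, or_false] at h
    refine ⟨i, ?_⟩
    rcases h.2 with h | h | h | h <;> simp [h.2.1]
  · simp [iRel] at h

lemma mem_longPathEdges {v : V} {j : Fin 8} (hj : j.val < 7) :
    s((Sum.inl (v, j) : IVert V), Sum.inl (v, j + 1)) ∈ longPathEdges v :=
  ⟨j, hj, rfl⟩

/-- A walk using the long path around a gadget cycle visits the whole cycle. -/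
lemma inl_mem_support_of_longPathEdges {x y : IVert V} {p : (instGraph G σ fs sn).Walk x y} {v : V}
    (hp : {e | e ∈ p.edges} = longPathEdges v) (j : Fin 8) : Sum.inl (v, j) ∈ p.support := by
  by_cases hj : j.val < 7
  · have : s((Sum.inl (v, j) : IVert V), Sum.inl (v, j + 1)) ∈ {e | e ∈ p.edges} :=
      hp ▸ mem_longPathEdges hj
    exact p.fst_mem_support_of_mem_edges this
  · obtain rfl : j = 6 + 1 := by omega
    have : s((Sum.inl (v, 6) : IVert V), Sum.inl (v, 6 + 1)) ∈ {e | e ∈ p.edges} :=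
      hp ▸ mem_longPathEdges (by decide)
    exact p.snd_mem_support_of_mem_edges this

lemma inr_notMem_of_mem_longPathEdges {v : V} {ε : Sym2 (IVert V)} (h : ε ∈ longPathEdges v)
    (a : Sym2 V × Fin 2) : Sum.inr a ∉ ε := by
  obtain ⟨j, -, rfl⟩ := h
  simp

variable [Fintype V] [DecidableEq V]

lemma inl_mem_instA {v : V} {j : Fin 8} :
    (Sum.inl (v, j) : IVert V) ∈ instA V ↔ j = 0 ∨ j = 7 := by
  simp [instA, eq_comm]

lemma inr_notMem_instA {a : Sym2 V × Fin 2} : (Sum.inr a : IVert V) ∉ instA V := by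
  simp [instA]

variable [DecidableRel G.Adj]

lemma inr_mem_instB {e : Sym2 V} {l : Fin 2} :
    (Sum.inr (e, l) : IVert V) ∈ instB G ↔ e ∈ G.edgeSet := by
  fin_cases l <;> simp [instB]

lemma inl_notMem_instB {a : V × Fin 8} : (Sum.inl a : IVert V) ∉ instB G := by
  simp [instB]

lemma disjoint_instA_instB : Disjoint (instA V) (instB G) := by
  rw [Finset.disjoint_left]
  rintro (a | a) h
  exacts [inl_notMem_instB, absurd h inr_notMem_instA]

/-- A path that starts at a non-initial vertex of a gadget cycle, avoids the preceding vertex,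
ends in `A` and meets no other terminal runs along the cycle to its last vertex. -/
lemma end_eq_and_edges_eq_of_avoid {v : V} {x t : IVert V} (p : (instGraph G σ fs sn).Walk x t)
    (j : Fin 8) (hx : x = .inl (v, j)) (hj : 0 < j.val) (hp : p.IsPath) (ht : t ∈ instA V)
    (hterm : ∀ z ∈ p.support, z ∈ instA V ∪ instB G → z = t)
    (hprev : ∀ i : Fin 8, i.val + 1 = j.val → Sum.inl (v, i) ∉ p.support) :
    t = .inl (v, 7) ∧ {e | e ∈ p.edges} =
      {ε | ∃ i : Fin 8, j ≤ i ∧ i.val < 7 ∧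
        ε = s((Sum.inl (v, i) : IVert V), Sum.inl (v, i + 1))} := by
  induction p generalizing j with
  | nil =>
    subst hx
    obtain rfl | rfl := inl_mem_instA.1 ht
    · simp at hj
    · refine ⟨rfl, ?_⟩
      ext ε
      simp only [Walk.edges_nil, List.not_mem_nil, Set.mem_ofPred_eq, false_iff]
      rintro ⟨i, h₁, h₂, -⟩
      exact absurd h₁ (by omega)
  | @cons x y t h q ih =>
    subst hx
    rw [Walk.cons_isPath_iff] at hp
    have hj7 : j ≠ 7 := by
      rintro rfl
      have := hterm _ (Walk.start_mem_support _) (Finset.mem_union_left _ (inl_mem_instA.2 (.inr rfl)))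
      exact hp.2 (this ▸ q.end_mem_support)
    have hq : ∀ z ∈ q.support, z ∈ instA V ∪ instB G → z = t := fun z hz =>
      hterm z (by simp [hz])
    obtain ⟨i, rfl, hi⟩ | ⟨e, he, l, rfl⟩ := instGraph_adj_inl h
    · have hji : j.val + 1 = i.val := by
        have : i.val + 1 ≠ j.val := fun hij => hprev i hij (by simp)
        omega
      obtain ⟨h₁, h₂⟩ := ih i rfl (by omega) hp.1 ht hq fun i' hi' => by
        obtain rfl : i' = j := by omega
        exact hp.2
      refine ⟨h₁, ?_⟩
      obtain rfl : i = j + 1 := by omega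
      ext ε
      have := Set.ext_iff.1 h₂ ε
      simp only [Set.mem_ofPred_eq] at this
      simp only [Walk.edges_cons, List.mem_cons, Set.mem_ofPred_eq, this]
      constructor
      · rintro (rfl | ⟨i, h₁, h₂, rfl⟩)
        · exact ⟨j, le_rfl, by omega, rfl⟩
        · exact ⟨i, by omega, h₂, rfl⟩
      · rintro ⟨i, h₁, h₂, rfl⟩
        rcases h₁.eq_or_lt with rfl | h₁
        · exact .inl rfl
        · exact .inr ⟨i, by omega, h₂, rfl⟩
    · have := hq _ q.start_mem_support (Finset.mem_union_right _ (inr_mem_instB.2 he))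
      exact absurd (this ▸ ht) inr_notMem_instA

/-- A nontrivial path from the first vertex of a gadget cycle to a vertex of `A` that meets no
other terminal ends at the last vertex of the cycle and is one of the two arcs. -/
lemma end_eq_and_edges_eq {v : V} {x t : IVert V} (p : (instGraph G σ fs sn).Walk x t)
    (hx : x = .inl (v, 0)) (hp : p.IsPath) (ht : t ∈ instA V) (hxt : x ≠ t)
    (hterm : ∀ z ∈ p.support, z ∈ instA V ∪ instB G → z = x ∨ z = t) :
    t = .inl (v, 7) ∧
      ({e | e ∈ p.edges} = {s((Sum.inl (v, (7 : Fin 8)) : IVert V), Sum.inl (v, (0 : Fin 8)))} ∨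
        {e | e ∈ p.edges} = longPathEdges v) := by
  subst hx
  cases p with
  | nil => exact absurd rfl hxt
  | @cons _ y _ h q =>
    rw [Walk.cons_isPath_iff] at hp
    have hq : ∀ z ∈ q.support, z ∈ instA V ∪ instB G → z = t := fun z hz hzt =>
      (hterm z (by simp [hz]) hzt).resolve_left fun h => hp.2 (h ▸ hz)
    obtain ⟨i, rfl, hi⟩ | ⟨e, he, l, rfl⟩ := instGraph_adj_inl h
    · have hi : i = 1 ∨ i = 7 := by simp only [Fin.val_zero] at hi; omega
      obtain rfl | rfl := hi
      · obtain ⟨h₁, h₂⟩ := end_eq_and_edges_eq_of_avoid q 1 rfl (by simp) hp.1 ht hq fun i hi => by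
          obtain rfl : i = 0 := by simp only [Fin.val_one] at hi; omega
          exact hp.2
        refine ⟨h₁, .inr ?_⟩
        ext ε
        have := Set.ext_iff.1 h₂ ε
        simp only [Set.mem_ofPred_eq] at this
        simp only [Walk.edges_cons, List.mem_cons, Set.mem_ofPred_eq, this, longPathEdges]
        constructor
        · rintro (rfl | ⟨i, h₁, h₂, rfl⟩)
          · exact ⟨0, by simp, rfl⟩
          · exact ⟨i, h₂, rfl⟩
        · rintro ⟨i, h₂, rfl⟩
          by_cases hi : i = 0
          · subst hi
            exact .inl rfl
          · exact .inr ⟨i, by omega, h₂, rfl⟩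
      · obtain rfl := hq _ q.start_mem_support
          (Finset.mem_union_left _ (inl_mem_instA.2 (.inr rfl)))
        obtain rfl := (Walk.isPath_iff_nil.1 hp.1).eq_nil
        refine ⟨rfl, .inl ?_⟩
        ext ε
        simp [Sym2.eq_swap]
    · have := hq _ q.start_mem_support (Finset.mem_union_right _ (inr_mem_instB.2 he))
      exact absurd (this ▸ ht) inr_notMem_instA

end Instance

/-!
STATEMENT 9.  In every solution `E′` to Disjoint `A`,`B`-paths on the instance `I`,
for each `v ∈ V` the path of `E′` having `v′₁` as an endpoint has its other endpoint
at `v′₈` and is either the single edge `v′₈v′₁` (of length 12) or the path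
`v′₁v′₂⋯v′₈` (of length 11); moreover the set
`S = {v ∈ V : the path of E′ joining v′₁ and v′₈ is v′₁v′₂⋯v′₈}` is an independent
set in `G`.
-/
theorem stmt9 {V : Type} [Fintype V] [DecidableEq V]
    (G : SimpleGraph V) [DecidableRel G.Adj]
    (hcubic : ∀ v : V, G.degree v = 3)
    (σ : V → Sym2 V → ℕ) (fs sn : Sym2 V → V)
    (hfssn : ∀ e ∈ G.edgeSet, e = s(fs e, sn e))
    (hσmem : ∀ v : V, ∀ e ∈ G.incidenceSet v, σ v e = 2 ∨ σ v e = 4 ∨ σ v e = 6)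
    (hσinj : ∀ v : V, Set.InjOn (σ v) (G.incidenceSet v))
    (E' : Set (Sym2 (IVert V))) (k : ℕ)
    (f : Fin k → (u : IVert V) × (w : IVert V) × (instGraph G σ fs sn).Walk u w)
    (hf : IsPathFamily (instGraph G σ fs sn) (instA V) (instB G) E' f) :
    (∀ (i : Fin k) (v : V),
      ((f i).1 = Sum.inl (v, (0 : Fin 8)) ∨ (f i).2.1 = Sum.inl (v, (0 : Fin 8))) →
      ({(f i).1, (f i).2.1} : Set (IVert V)) =
        {Sum.inl (v, (0 : Fin 8)), Sum.inl (v, (7 : Fin 8))} ∧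
      ({e | e ∈ (f i).2.2.edges} =
          {s((Sum.inl (v, (7 : Fin 8)) : IVert V), Sum.inl (v, (0 : Fin 8)))} ∨
        {e | e ∈ (f i).2.2.edges} = longPathEdges v)) ∧
    (∀ u w : V,
      (∃ i, {e | e ∈ (f i).2.2.edges} = longPathEdges u) →
      (∃ i, {e | e ∈ (f i).2.2.edges} = longPathEdges w) →
      ¬ G.Adj u w) := by
  have hne := hf.fst_ne_snd disjoint_instA_instB
  have hend := fun i z => hf.eq_fst_or_snd_of_mem_support (i := i) (z := z)
  obtain ⟨-, hpath, hAB, hdisj, hcov, -⟩ := hf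
  constructor
  · rintro i v (hv | hv)
    · have hA := ((hAB i).resolve_right fun h => inl_notMem_instB (hv ▸ h.1)).2
      obtain ⟨h₁, h₂⟩ := end_eq_and_edges_eq (f i).2.2 hv (hpath i) hA (hne i)
        fun z hz hzt => hend i z hzt hz
      exact ⟨congrArg₂ (fun x y => ({x, y} : Set (IVert V))) hv h₁, h₂⟩
    · have hA := ((hAB i).resolve_right fun h => inl_notMem_instB (hv ▸ h.2)).1
      obtain ⟨h₁, h₂⟩ := end_eq_and_edges_eq (f i).2.2.reverse hv (hpath i).reverse hA (hne i).symm
        fun z hz hzt => (hend i z hzt (by simpa using hz)).symm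
      refine ⟨(congrArg₂ (fun x y => ({x, y} : Set (IVert V))) h₁ hv).trans (Set.pair_comm _ _), ?_⟩
      simpa only [Walk.edges_reverse, List.mem_reverse] using h₂
  · rintro u w ⟨a, ha⟩ ⟨b, hb⟩ huw
    have he : s(u, w) ∈ G.edgeSet := huw
    obtain ⟨i, hi⟩ := hcov (.inr (s(u, w), 0)) (Finset.mem_union_right _ (inr_mem_instB.2 he))
    obtain ⟨y, hy⟩ : ∃ y, s(.inr (s(u, w), 0), y) ∈ (f i).2.2.edges := by
      rcases hi with hi | hi
      · obtain ⟨y, h, q, hq⟩ := Walk.not_nil_iff.1 (Walk.not_nil_of_ne (p := (f i).2.2) (hne i))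
        exact ⟨y, by rw [hi, hq]; simp⟩
      · obtain ⟨y, h, q, hq⟩ := Walk.not_nil_iff.1
          (Walk.not_nil_of_ne (p := (f i).2.2.reverse) (hne i).symm)
        refine ⟨y, ?_⟩
        rw [← List.mem_reverse, ← Walk.edges_reverse, hi, hq]
        simp
    have not_long : ∀ v c j, {e | e ∈ (f c).2.2.edges} = longPathEdges v → y ≠ .inl (v, j) := by
      rintro v c j hc rfl
      obtain rfl : i = c := by_contra fun h =>
        hdisj i c h _ (Walk.snd_mem_support_of_mem_edges _ hy)
          (inl_mem_support_of_longPathEdges hc j)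
      have hy' : _ ∈ {e | e ∈ (f i).2.2.edges} := hy
      rw [hc] at hy'
      exact inr_notMem_of_mem_longPathEdges hy' _ (Sym2.mem_mk_left _ _)
    obtain ⟨j, hj⟩ := instGraph_adj_inr (Walk.adj_of_mem_edges _ hy)
    have := hfssn _ he
    rw [Sym2.eq_iff] at this
    obtain ⟨h₁, h₂⟩ | ⟨h₁, h₂⟩ := this <;> rw [← h₁, ← h₂] at hj <;> rcases hj with hj | hj
    · exact not_long u a j ha hj
    · exact not_long w b j hb hj
    · exact not_long w b j hb hj
    · exact not_long u a j ha hj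
end

section
/- Suppose a ∈ A has degree 1 in G with unique neighbor u, and u ∉ A ∪ B. Let G′ = G − a with terminal sets A′ = (A∖{a}) ∪ {u} and B and the restricted length function. Then the map E′ ↦ E′∖{ua} is a bijection between solutions of Disjoint A,B-paths on G and solutions of Disjoint A′,B-paths on G′, and it decreases the length by exactly ℓ(ua). In particular, a solution on G exists if and only if one on G′ exists, and in that case ℓ_{A,B}(G) = ℓ(ua) + ℓ_{A′,B}(G′) and S_{A,B}(G) = S_{A′,B}(G′). -/
/-- If `A` and `B` are disjoint sets of even size, the two endpoints of each path of a path family are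
distinct. -/
lemma IsPathFamily.endpoints_ne {V : Type} [DecidableEq V] {G : SimpleGraph V} {A B : Finset V}
    {E : Set (Sym2 V)} {k : ℕ} {f : Fin k → (u : V) × (v : V) × G.Walk u v}
    (hf : IsPathFamily G A B E f) (hdisj : Disjoint A B) (hA : Even A.card) (hB : Even B.card)
    (i : Fin k) : (f i).1 ≠ (f i).2.1 := by
  obtain ⟨hk, -, hend, -, hcov, -⟩ := hf
  let g : Fin k × Bool → V := fun x => if x.2 then (f x.1).1 else (f x.1).2.1
  have himg : Finset.univ.image g = A ∪ B := by
    ext z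
    simp only [Finset.mem_image, Finset.mem_univ, true_and]
    constructor
    · rintro ⟨⟨j, b⟩, rfl⟩
      have := hend j
      cases b <;> simp only [g, Finset.mem_union] <;> simp <;> tauto
    · intro hz
      obtain ⟨j, hj | hj⟩ := hcov z hz
      · exact ⟨(j, true), by simp [g, hj]⟩
      · exact ⟨(j, false), by simp [g, hj]⟩
  have hcard : (Finset.univ.image g).card = (Finset.univ : Finset (Fin k × Bool)).card := by
    rw [himg, Finset.card_union_of_disjoint hdisj]
    obtain ⟨m, hm⟩ := hA
    obtain ⟨n, hn⟩ := hB
    simp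
    omega
  have hinj := Finset.card_image_iff.1 hcard
  intro h
  have := @hinj (i, true) (by simp) (i, false) (by simp) (by simp [g, h])
  simp at this

/-- Replacing the path at index `i`, which joins `z` and `v`, by a path `q` from `w` to `v`. -/
lemma IsPathFamily.replace {V : Type} [DecidableEq V] {G H : SimpleGraph V} {A B : Finset V}
    {E : Set (Sym2 V)} {k : ℕ} {f : Fin k → (u : V) × (v : V) × G.Walk u v}
    (hf : IsPathFamily G A B E f) {i : Fin k} {z v w : V} (hz : z ∈ A) (hv : v ∈ A) (hvz : v ≠ z)
    (hzB : z ∉ B) (hzi : z ∈ (f i).2.2.support)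
    (hi : ∀ x, (x = (f i).1 ∨ x = (f i).2.1) ↔ (x = z ∨ x = v))
    (q : H.Walk w v) (hq : q.IsPath) (hw : w ∉ A.erase z)
    (hH : ∀ j ≠ i, ∀ e ∈ (f j).2.2.edges, e ∈ H.edgeSet)
    (hS : ∀ j ≠ i, ∀ x ∈ (f j).2.2.support, x ∉ q.support) :
    IsSolution H (insert w (A.erase z)) B
      ({e | e ∈ q.edges} ∪ {e | ∃ j ≠ i, e ∈ (f j).2.2.edges}) := by
  obtain ⟨hk, hpath, hend, hdis, hcov, -⟩ := hf
  let g : Fin k → (u : V) × (v : V) × H.Walk u v := fun j =>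
    if h : j = i then ⟨w, v, q⟩ else ⟨(f j).1, (f j).2.1, (f j).2.2.transfer H (hH j h)⟩
  have gi : g i = ⟨w, v, q⟩ := by simp [g]
  have gj : ∀ j (h : j ≠ i), g j = ⟨(f j).1, (f j).2.1, (f j).2.2.transfer H (hH j h)⟩ := by
    intro j h
    simp [g, h]
  refine ⟨k, g, ?_, ?_, ?_, ?_, ?_, ?_⟩
  · rw [Finset.card_insert_of_notMem hw, Finset.card_erase_add_one hz, hk]
  · intro j
    by_cases h : j = i
    · subst h
      rw [gi]
      exact hq
    · rw [gj j h]
      exact (hpath j).transfer _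
  · intro j
    by_cases h : j = i
    · subst h
      rw [gi]
      left
      simp [hv, hvz]
    · rw [gj j h]
      have h1 : (f j).1 ≠ z := fun e =>
        hdis j i h (f j).1 (SimpleGraph.Walk.start_mem_support _) (e ▸ hzi)
      have h2 : (f j).2.1 ≠ z := fun e =>
        hdis j i h (f j).2.1 (SimpleGraph.Walk.end_mem_support _) (e ▸ hzi)
      have := hend j
      simp only [Finset.mem_insert, Finset.mem_erase]
      tauto
  · intro j l hjl x hx
    by_cases h : j = i
    · subst h
      rw [gi] at hx
      rw [gj l hjl.symm, SimpleGraph.Walk.support_transfer]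
      exact fun hx' => hS l hjl.symm x hx' hx
    · rw [gj j h, SimpleGraph.Walk.support_transfer] at hx
      by_cases h' : l = i
      · subst h'
        rw [gi]
        exact hS j h x hx
      · rw [gj l h', SimpleGraph.Walk.support_transfer]
        exact hdis j l hjl x hx
  · intro x hx
    by_cases hxw : x = w
    · exact ⟨i, Or.inl (by rw [gi, hxw])⟩
    · have hx' : x ≠ z ∨ x ∈ B := by
        simp only [Finset.mem_union, Finset.mem_insert, Finset.mem_erase] at hx
        tauto
      have hxAB : x ∈ A ∪ B := by
        simp only [Finset.mem_union, Finset.mem_insert, Finset.mem_erase] at hx ⊢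
        tauto
      obtain ⟨j, hj⟩ := hcov x hxAB
      by_cases h : j = i
      · subst h
        rcases (hi x).1 hj with rfl | rfl
        · exact absurd hx' (by simp [hzB])
        · exact ⟨j, Or.inr (by rw [gi])⟩
      · exact ⟨j, by rw [gj j h]; exact hj⟩
  · ext e
    simp only [Set.mem_union, Set.mem_ofPred_eq, Set.mem_iUnion]
    constructor
    · rintro (he | ⟨j, hj, he⟩)
      · exact ⟨i, by rw [gi]; exact he⟩
      · exact ⟨j, by rw [gj j hj, SimpleGraph.Walk.edges_transfer]; exact he⟩
    · rintro ⟨j, he⟩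
      by_cases h : j = i
      · subst h
        rw [gi] at he
        exact Or.inl he
      · rw [gj j h, SimpleGraph.Walk.edges_transfer] at he
        exact Or.inr ⟨j, h, he⟩

/-- A solution splits into the path `p` at a terminal `z ∈ A` and the remaining paths, which have
edge set `R` and vertex set `S`. The path `p` may be replaced by any path `q` from a new terminal
to the other end of `p` that avoids `S`. -/
lemma IsSolution.exists_split {V : Type} [DecidableEq V] {G : SimpleGraph V} {A B : Finset V}
    {E : Set (Sym2 V)} (hE : IsSolution G A B E) (hdisj : Disjoint A B) (hA : Even A.card)
    (hB : Even B.card) {z : V} (hz : z ∈ A) :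
    ∃ (v : V) (p : G.Walk z v) (R : Set (Sym2 V)) (S : Set V),
      p.IsPath ∧ v ∈ A ∧ v ≠ z ∧ E = {e | e ∈ p.edges} ∪ R ∧ R ⊆ G.edgeSet ∧
      (∀ x ∈ S, x ∉ p.support) ∧ (∀ e ∈ R, ∀ x ∈ e, x ∈ S) ∧
      (∀ x ∈ S, x ∈ A ∪ B ∨ ∃ e ∈ R, x ∈ e) ∧
      ∀ (H : SimpleGraph V) (w : V) (q : H.Walk w v), q.IsPath → w ∉ A.erase z →
        R ⊆ H.edgeSet → (∀ x ∈ S, x ∉ q.support) →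
        IsSolution H (insert w (A.erase z)) B ({e | e ∈ q.edges} ∪ R) := by
  obtain ⟨k, f, hf⟩ := hE
  have hf' := hf
  obtain ⟨-, hpath, hend, hdis, hcov, hEeq⟩ := hf'
  have hzB : z ∉ B := Finset.disjoint_left.1 hdisj hz
  obtain ⟨i, hi⟩ := hcov z (Finset.mem_union_left _ hz)
  have hne := hf.endpoints_ne hdisj hA hB i
  obtain ⟨v, p, hp, hv, hvz, hsupp, hedges, hends⟩ : ∃ (v : V) (p : G.Walk z v),
      p.IsPath ∧ v ∈ A ∧ v ≠ z ∧ (∀ x, x ∈ p.support ↔ x ∈ (f i).2.2.support) ∧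
      (∀ e, e ∈ p.edges ↔ e ∈ (f i).2.2.edges) ∧
      (∀ x, (x = (f i).1 ∨ x = (f i).2.1) ↔ (x = z ∨ x = v)) := by
    have hei := hend i
    rcases hi with rfl | rfl
    · exact ⟨_, (f i).2.2, hpath i, by tauto, hne.symm, by simp, by simp, by simp⟩
    · exact ⟨_, (f i).2.2.reverse, (hpath i).reverse, by tauto, hne, by simp, by simp,
        fun x => or_comm⟩
  refine ⟨v, p, {e | ∃ j ≠ i, e ∈ (f j).2.2.edges}, {x | ∃ j ≠ i, x ∈ (f j).2.2.support},
    hp, hv, hvz, ?_, ?_, ?_, ?_, ?_, ?_⟩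
  · rw [hEeq]
    ext e
    simp only [Set.mem_union, Set.mem_ofPred_eq, Set.mem_iUnion, hedges]
    constructor
    · rintro ⟨j, he⟩
      by_cases h : j = i
      · exact Or.inl (h ▸ he)
      · exact Or.inr ⟨j, h, he⟩
    · rintro (he | ⟨j, -, he⟩)
      exacts [⟨i, he⟩, ⟨j, he⟩]
  · rintro e ⟨j, -, he⟩
    exact SimpleGraph.Walk.edges_subset_edgeSet _ he
  · rintro x ⟨j, hj, hx⟩
    rw [hsupp]
    exact hdis j i hj x hx
  · rintro e ⟨j, hj, he⟩ x hx
    exact ⟨j, hj, SimpleGraph.Walk.mem_support_of_mem_edges he hx⟩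
  · rintro x ⟨j, hj, hx⟩
    rw [SimpleGraph.Walk.mem_support_iff_exists_mem_edges] at hx
    rcases hx with rfl | ⟨e, he, hxe⟩
    · left
      have := hend j
      simp only [Finset.mem_union]
      tauto
    · exact Or.inr ⟨e, ⟨j, hj, he⟩, hxe⟩
  · intro H w q hq hw hR hS
    exact hf.replace hz hv hvz hzB ((hsupp z).1 p.start_mem_support) hends q hq hw
      (fun j hj e he => hR ⟨j, hj, he⟩) (fun j hj x hx => hS x ⟨j, hj, hx⟩)

lemma IsSolution.subset_edgeSet {V : Type} [DecidableEq V] {G : SimpleGraph V} {A B : Finset V}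
    {E : Set (Sym2 V)} (hE : IsSolution G A B E) : E ⊆ G.edgeSet := by
  obtain ⟨k, f, -, -, -, -, -, rfl⟩ := hE
  exact Set.iUnion_subset fun i e he => SimpleGraph.Walk.edges_subset_edgeSet _ he

/-- Deleting a pendant terminal `a` with neighbor `u` turns solutions into solutions. -/
lemma IsSolution.delete_pendant {V : Type} [DecidableEq V] {G G' : SimpleGraph V} {A B : Finset V}
    {E : Set (Sym2 V)} (hE : IsSolution G A B E) (hdisj : Disjoint A B) (hA : Even A.card)
    (hB : Even B.card) {a u : V} (ha : a ∈ A) (hnb : G.neighborSet a = {u}) (hu : u ∉ A)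
    (hG' : ∀ x y, G'.Adj x y ↔ G.Adj x y ∧ x ≠ a ∧ y ≠ a) :
    s(u, a) ∈ E ∧ IsSolution G' (insert u (A.erase a)) B (E \ {s(u, a)}) := by
  obtain ⟨v, p, R, S, hp, -, hva, rfl, hR, hSp, hRS, -, hrep⟩ := hE.exists_split hdisj hA hB ha
  have haS : a ∉ S := fun h => hSp a h p.start_mem_support
  have mem_edgeSet : ∀ e ∈ G.edgeSet, a ∉ e → e ∈ G'.edgeSet := by
    intro e
    induction e with
    | _ x y =>
      intro he hae
      simp only [Sym2.mem_iff, not_or] at hae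
      exact (hG' x y).2 ⟨he, Ne.symm hae.1, Ne.symm hae.2⟩
  cases p with
  | nil => exact absurd rfl hva
  | @cons _ c _ h p =>
    obtain rfl : c = u := by
      have : c ∈ G.neighborSet a := h
      rwa [hnb] at this
    rw [SimpleGraph.Walk.cons_isPath_iff] at hp
    obtain ⟨hp, hap⟩ := hp
    have hpe : ∀ e ∈ p.edges, a ∉ e := fun e he hae =>
      hap (SimpleGraph.Walk.mem_support_of_mem_edges he hae)
    refine ⟨by simp [Sym2.eq_swap], ?_⟩
    have key := hrep G' c
      (p.transfer G' fun e he => mem_edgeSet e (p.edges_subset_edgeSet he) (hpe e he))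
      (hp.transfer _) (fun h => hu (Finset.mem_of_mem_erase h))
      (fun e he => mem_edgeSet e (hR he) fun hae => haS (hRS e he a hae))
      (fun x hx hx' => hSp x hx (by
        rw [SimpleGraph.Walk.support_transfer] at hx'
        simp [hx']))
    convert key using 1
    ext e
    have h1 : e ∈ p.edges → e ≠ s(c, a) := by
      rintro he rfl
      exact hpe _ he (by simp)
    have h2 : e ∈ R → e ≠ s(c, a) := by
      rintro he rfl
      exact haS (hRS _ he a (by simp))
    simp only [SimpleGraph.Walk.edges_cons, SimpleGraph.Walk.edges_transfer, Set.mem_sdiff,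
      Set.mem_union, Set.mem_ofPred_eq, List.mem_cons, Set.mem_singleton_iff,
      Sym2.eq_swap (a := a) (b := c)]
    tauto

/-- Extending the path at `u` by a pendant edge to a new terminal `a`. -/
lemma IsSolution.insert_pendant {V : Type} [DecidableEq V] {G G' : SimpleGraph V} {A B : Finset V}
    {E : Set (Sym2 V)} (hE : IsSolution G' A B E) (hdisj : Disjoint A B) (hA : Even A.card)
    (hB : Even B.card) {a u : V} (ha : a ∉ A ∪ B) (hu : u ∈ A) (hadj : G.Adj a u)
    (hle : G' ≤ G) (hG' : ∀ y, ¬ G'.Adj a y) :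
    IsSolution G (insert a (A.erase u)) B (insert s(u, a) E) := by
  obtain ⟨v, p, R, S, hp, hv, -, rfl, hR, hSp, hRS, hST, hrep⟩ := hE.exists_split hdisj hA hB hu
  have hedge : ∀ e ∈ G'.edgeSet, a ∉ e := by
    intro e he hae
    obtain ⟨y, rfl⟩ := Sym2.mem_iff_exists.1 hae
    exact hG' y he
  have hap : a ∉ p.support := by
    rw [SimpleGraph.Walk.mem_support_iff_exists_mem_edges]
    rintro (rfl | ⟨e, he, hae⟩)
    · exact ha (Finset.mem_union_left _ hv)
    · exact hedge e (p.edges_subset_edgeSet he) hae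
  have haS : a ∉ S := by
    intro h
    rcases hST a h with h | ⟨e, he, hae⟩
    exacts [ha h, hedge e (hR he) hae]
  have key := hrep G a (SimpleGraph.Walk.cons hadj (p.mapLe hle))
    ((SimpleGraph.Walk.cons_isPath_iff _ _).2
      ⟨(SimpleGraph.Walk.isPath_mapLe hle).2 hp, by simpa using hap⟩)
    (fun h => ha (Finset.mem_union_left _ (Finset.mem_of_mem_erase h)))
    (hR.trans (SimpleGraph.edgeSet_mono hle))
    (by
      intro x hx
      have hxa : x ≠ a := fun h => haS (h ▸ hx)
      simpa [hxa] using hSp x hx)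
  convert key using 1
  ext e
  simp [Sym2.eq_swap (a := a) (b := u), or_assoc]

/-- A bijection between solution sets that shifts every length by `c` shifts the minimum length by
`c` and preserves the number of minimum-length solutions. -/
lemma lAB_nSol_of_bijOn {V : Type} [DecidableEq V] {G G' : SimpleGraph V} {A A' B : Finset V}
    {ℓ : Sym2 V → ℕ} {c : ℕ} {φ : Set (Sym2 V) → Set (Sym2 V)}
    (hφ : Set.BijOn φ {E | IsSolution G A B E} {E | IsSolution G' A' B E})
    (hlen : ∀ E, IsSolution G A B E → lengthOf ℓ (φ E) + c = lengthOf ℓ E)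
    (hex : ∃ E, IsSolution G A B E) :
    lAB G A B ℓ = c + lAB G' A' B ℓ ∧ nSol G A B ℓ = nSol G' A' B ℓ := by
  obtain ⟨E₀, hE₀⟩ := hex
  have hmin : lAB G A B ℓ = c + lAB G' A' B ℓ := by
    obtain ⟨E, hE, hEl⟩ := Nat.sInf_mem
      (s := {n | ∃ E', IsSolution G A B E' ∧ lengthOf ℓ E' = n}) ⟨_, E₀, hE₀, rfl⟩
    obtain ⟨F, hF, hFl⟩ := Nat.sInf_mem
      (s := {n | ∃ E', IsSolution G' A' B E' ∧ lengthOf ℓ E' = n}) ⟨_, φ E₀, hφ.mapsTo hE₀, rfl⟩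
    obtain ⟨F₀, hF₀, rfl⟩ := hφ.surjOn hF
    have h1 : lAB G A B ℓ ≤ lengthOf ℓ F₀ := Nat.sInf_le ⟨F₀, hF₀, rfl⟩
    have h2 : lAB G' A' B ℓ ≤ lengthOf ℓ (φ E) := Nat.sInf_le ⟨φ E, hφ.mapsTo hE, rfl⟩
    have h3 := hlen E hE
    have h4 := hlen F₀ hF₀
    change lengthOf ℓ E = lAB G A B ℓ at hEl
    change lengthOf ℓ (φ F₀) = lAB G' A' B ℓ at hFl
    omega
  refine ⟨hmin, Set.BijOn.ncard_eq (f := φ) ⟨?_, ?_, ?_⟩⟩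
  · rintro E ⟨hE, hEl⟩
    have := hlen E hE
    exact ⟨hφ.mapsTo hE, by omega⟩
  · exact hφ.injOn.mono fun E hE => hE.1
  · rintro F ⟨hF, hFl⟩
    obtain ⟨E, hE, rfl⟩ := hφ.surjOn hF
    have := hlen E hE
    exact ⟨E, ⟨hE, by omega⟩, rfl⟩

/-!
STATEMENT 12.  Suppose `a ∈ A` has degree 1 in `G` with unique neighbor `u`, and
`u ∉ A ∪ B`.  Let `G′ = G − a` with terminal sets `A′ = (A∖{a}) ∪ {u}` and `B`.
Then `E′ ↦ E′ ∖ {ua}` is a bijection between solutions of Disjoint `A`,`B`-paths on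
`G` and solutions of Disjoint `A′`,`B`-paths on `G′` decreasing the length by exactly
`ℓ(ua)`; in particular a solution on `G` exists iff one on `G′` exists, and then
`ℓ_{A,B}(G) = ℓ(ua) + ℓ_{A′,B}(G′)` and `S_{A,B}(G) = S_{A′,B}(G′)`.
-/
theorem stmt12 {V : Type} [Fintype V] [DecidableEq V]
    (G : SimpleGraph V) (A B : Finset V) (ℓ : Sym2 V → ℕ)
    (hdisj : Disjoint A B) (hA : Even A.card) (hB : Even B.card)
    (hℓ : ∀ e ∈ G.edgeSet, 1 ≤ ℓ e)
    (a u : V) (ha : a ∈ A) (hnb : G.neighborSet a = {u}) (hu : u ∉ A ∪ B)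
    (G' : SimpleGraph V)
    (hG' : G' = SimpleGraph.fromRel (fun x y => G.Adj x y ∧ x ≠ a ∧ y ≠ a))
    (A' : Finset V) (hA' : A' = insert u (A.erase a)) :
    Set.BijOn (fun E' => E' \ {s(u, a)})
      {E' | IsSolution G A B E'} {E'' | IsSolution G' A' B E''} ∧
    (∀ E', IsSolution G A B E' →
      lengthOf ℓ (E' \ {s(u, a)}) + ℓ s(u, a) = lengthOf ℓ E') ∧
    ((∃ E', IsSolution G A B E') ↔ ∃ E'', IsSolution G' A' B E'') ∧
    ((∃ E', IsSolution G A B E') →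
      lAB G A B ℓ = ℓ s(u, a) + lAB G' A' B ℓ ∧
      nSol G A B ℓ = nSol G' A' B ℓ) := by
  have hadj : G.Adj a u := by
    change u ∈ G.neighborSet a
    simp [hnb]
  have hua : u ≠ a := hadj.ne'
  rw [Finset.mem_union, not_or] at hu
  have hAdj : ∀ x y, G'.Adj x y ↔ G.Adj x y ∧ x ≠ a ∧ y ≠ a := by
    intro x y
    rw [hG', SimpleGraph.fromRel_adj]
    have := G.adj_comm x y
    have : G.Adj x y → x ≠ y := SimpleGraph.Adj.ne
    tauto
  have hdel : ∀ E, IsSolution G A B E →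
      s(u, a) ∈ E ∧ IsSolution G' A' B (E \ {s(u, a)}) := by
    rw [hA']
    exact fun E hE => hE.delete_pendant hdisj hA hB ha hnb hu.1 hAdj
  have haB : a ∉ B := Finset.disjoint_left.1 hdisj ha
  have hins : ∀ E, IsSolution G' A' B E → IsSolution G A B (insert s(u, a) E) := by
    intro E hE
    have hback : insert a (A'.erase u) = A := by
      rw [hA', Finset.erase_insert (fun h => hu.1 (Finset.mem_of_mem_erase h)),
        Finset.insert_erase ha]
    rw [← hback]
    refine hE.insert_pendant ?_ ?_ hB ?_ ?_ hadj (fun x y h => ((hAdj x y).1 h).1)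
      (fun y h => ((hAdj a y).1 h).2.1 rfl)
    · rw [hA', Finset.disjoint_insert_left]
      exact ⟨hu.2, hdisj.mono_left (Finset.erase_subset _ _)⟩
    · rwa [hA', Finset.card_insert_of_notMem (fun h => hu.1 (Finset.mem_of_mem_erase h)),
        Finset.card_erase_add_one ha]
    · simp [hA', hua.symm, haB]
    · simp [hA']
  have hbij : Set.BijOn (fun E' => E' \ {s(u, a)})
      {E' | IsSolution G A B E'} {E'' | IsSolution G' A' B E''} := by
    refine ⟨fun E hE => (hdel E hE).2, fun E hE F hF h => ?_, fun E hE => ?_⟩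
    · rw [← Set.insert_sdiff_self_of_mem (hdel E hE).1, ← Set.insert_sdiff_self_of_mem (hdel F hF).1]
      exact congrArg (insert s(u, a)) h
    · refine ⟨insert s(u, a) E, hins E hE, Set.insert_sdiff_self_of_notMem fun h => ?_⟩
      exact ((hAdj u a).1 (hE.subset_edgeSet h)).2.2 rfl
  have hlen : ∀ E', IsSolution G A B E' →
      lengthOf ℓ (E' \ {s(u, a)}) + ℓ s(u, a) = lengthOf ℓ E' := by
    intro E hE
    conv_rhs => rw [← Set.insert_sdiff_self_of_mem (hdel E hE).1]
    rw [lengthOf, lengthOf, finsum_mem_insert _ (by simp) (Set.toFinite _), add_comm]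
  exact ⟨hbij, hlen, ⟨fun ⟨E, hE⟩ => ⟨_, (hdel E hE).2⟩, fun ⟨E, hE⟩ => ⟨_, hins E hE⟩⟩,
    lAB_nSol_of_bijOn hbij hlen⟩
end
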